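/- Two rules r and r' (with r ≠ r') of an extended logic program are conflicting if and only if the following three conditions hold: (CP1) the head literals H(r) and H(r') are strongly complementary; (CP2) B+(r) ∩ B−(r') = ∅ and B+(r') ∩ B−(r) = ∅; and (CP3) the set B+(r) ∪ B+(r') is consistent. (Here all rules are assumed applicable, so in particular B+(r) ∩ B−(r) = ∅, B+(r') ∩ B−(r') = ∅, and B+(r), B+(r') are each consistent.) -/

import Mathlib

/-! ## Classical and extended literals -/

/-- A classical literal over atoms `A`: an atom `a` (positive) or a strongly
negated atom `¬a` (negative). -/
inductive CLit (A : Type) : Type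
  | pos : A → CLit A
  | neg : A → CLit A
deriving DecidableEq

namespace CLit

/-- The strong complement of a classical literal. -/
def compl {A : Type} : CLit A → CLit A
  | pos a => neg a
  | neg a => pos a

/-- The underlying atom of a classical literal. -/
def atom {A : Type} : CLit A → A
  | pos a => a
  | neg a => a

end CLit

/-- Two classical literals are strongly complementary. -/
def StronglyComp {A : Type} (L L' : CLit A) : Prop := L' = L.compl

/-- A set of classical literals is consistent iff it contains no strongly
complementary pair. -/
def Consistent {A : Type} (S : Set (CLit A)) : Prop := ∀ L ∈ S, L.compl ∉ S

/-- An extended literal: a classical literal `L` or a default-negated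
classical literal `not L`. -/
inductive ELit (A : Type) : Type
  | lit : CLit A → ELit A
  | not : CLit A → ELit A
deriving DecidableEq

namespace ELit

/-- The underlying atom of an extended literal. -/
def atom {A : Type} : ELit A → A
  | lit L => L.atom
  | not L => L.atom

end ELit

/-- Two extended literals are atom-related iff they have the same underlying atom. -/
def AtomRelated {A : Type} (e e' : ELit A) : Prop := e.atom = e'.atom

/-- Strongly complementary extended literals: `L` and its strong complement. -/
def EStrComp {A : Type} (e e' : ELit A) : Prop :=
  ∃ L : CLit A, e = ELit.lit L ∧ e' = ELit.lit L.compl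

/-- Default complementary extended literals: `L` and `not L`. -/
def EDefComp {A : Type} (e e' : ELit A) : Prop :=
  ∃ L : CLit A, (e = ELit.lit L ∧ e' = ELit.not L) ∨ (e = ELit.not L ∧ e' = ELit.lit L)

/-- Complementary extended literals: strongly or default complementary. -/
def EComp {A : Type} (e e' : ELit A) : Prop := EStrComp e e' ∨ EDefComp e e'

/-- Dual extended literals: `L` and `not (strong complement of L)`. -/
def EDual {A : Type} (e e' : ELit A) : Prop :=
  ∃ L : CLit A, (e = ELit.lit L ∧ e' = ELit.not L.compl) ∨ (e = ELit.not L.compl ∧ e' = ELit.lit L)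

/-- Reconcilable extended literals: `not L` and `not (strong complement of L)`. -/
def EReconc {A : Type} (e e' : ELit A) : Prop :=
  ∃ L : CLit A, e = ELit.not L ∧ e' = ELit.not L.compl

/-- Satisfaction of an extended literal by a set of classical literals:
`S ⊨ L` iff `L ∈ S`, and `S ⊨ not L` iff `L ∉ S`. -/
def SatE {A : Type} (S : Set (CLit A)) : ELit A → Prop
  | ELit.lit L => L ∈ S
  | ELit.not L => L ∉ S

/-- A set `S` of classical literals satisfies a set `X` of extended literals
iff it satisfies every element of `X`. -/
def SatAll {A : Type} (S : Set (CLit A)) (X : Set (ELit A)) : Prop := ∀ e ∈ X, SatE S e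

/-! ## Rules and programs -/

/-- A rule: a head (a classical literal) and a finite body of extended literals. -/
structure Rule (A : Type) where
  head : CLit A
  body : Finset (ELit A)

/-- The classical literals occurring positively in the body, `B⁺(r)`. -/
def Rule.bodyPos {A : Type} (r : Rule A) : Set (CLit A) := {L | ELit.lit L ∈ r.body}

/-- The classical literals occurring default-negated in the body, `B⁻(r)`. -/
def Rule.bodyNeg {A : Type} (r : Rule A) : Set (CLit A) := {L | ELit.not L ∈ r.body}

/-- A rule is applicable iff some consistent set of classical literals
satisfies its body. -/
def Applicable {A : Type} (r : Rule A) : Prop :=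
  ∃ S : Set (CLit A), Consistent S ∧ SatAll S ↑r.body

/-- Two rules `r ≠ r'` are conflicting iff their heads are strongly complementary
and some consistent set of classical literals satisfies both bodies. -/
def Conflicting {A : Type} (r r' : Rule A) : Prop :=
  r ≠ r' ∧ StronglyComp r.head r'.head ∧
    ∃ S : Set (CLit A), Consistent S ∧ SatAll S ↑r.body ∧ SatAll S ↑r'.body

/-! ## Answer set semantics -/

/-- `S` is a model of the positive parts: for each rule, the head is in `S`
whenever the positive body is contained in `S`. -/
def PModel {A : Type} (P : Set (Rule A)) (S : Set (CLit A)) : Prop :=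
  ∀ r ∈ P, r.bodyPos ⊆ S → r.head ∈ S

/-- The least model of a program without default negation. -/
def leastModel {A : Type} (P : Set (Rule A)) : Set (CLit A) := ⋂₀ {S | PModel P S}

open Classical in
/-- The answer set of a program without default negation: the least model if it
is consistent, and the set `Lit_A` of all classical literals otherwise. -/
noncomputable def posAnswerSet {A : Type} (P : Set (Rule A)) : Set (CLit A) :=
  if Consistent (leastModel P) then leastModel P else Set.univ

/-- Whether an extended literal is a (positive occurrence of a) classical literal. -/
def ELit.isPos {A : Type} : ELit A → Bool
  | ELit.lit _ => true
  | ELit.not _ => false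

/-- The reduct `P^S`: keep the rules with `B⁻(r) ∩ S = ∅`, as `H(r) ← B⁺(r)`. -/
def reduct {A : Type} (P : Set (Rule A)) (S : Set (CLit A)) : Set (Rule A) :=
  {r' | ∃ r ∈ P, r.bodyNeg ∩ S = ∅ ∧ r' = ⟨r.head, r.body.filter (fun e => e.isPos)⟩}

/-- `S` is an answer set of `P` iff `S` is the answer set of the reduct `P^S`. -/
def AnswerSet {A : Type} (P : Set (Rule A)) (S : Set (CLit A)) : Prop :=
  S = posAnswerSet (reduct P S)

/-- The fact corresponding to a classical literal: a rule with empty body. -/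
def fact {A : Type} (L : CLit A) : Rule A := ⟨L, ∅⟩

/-! ## Blankets and the negation operator -/

/-- The adversarial rules of `r` in the program `P`. -/
def Adv {A : Type} (P : Set (Rule A)) (r : Rule A) : Set (Rule A) :=
  {r' ∈ P | Conflicting r r'}

/-- The negation operator on extended literals:
`neg a = {not a, ¬a}`, `neg ¬a = {not ¬a, a}`, `neg (not a) = {a}`, `neg (not ¬a) = {¬a}`. -/
def negE {A : Type} : ELit A → Set (ELit A)
  | ELit.lit L => {ELit.not L, ELit.lit L.compl}
  | ELit.not L => {ELit.lit L}

/-- `neg(e, X) = ⋂ {neg k : k ∈ X, k atom-related to e}`. -/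
def negDep {A : Type} (e : ELit A) (X : Set (ELit A)) : Set (ELit A) :=
  ⋂ k ∈ {k ∈ X | AtomRelated k e}, negE k

/-- `Neg(X)`: all sets `T` of extended literals containing exactly one element of
each nonempty set `neg(e, X)` for `e ∈ X`, and nothing else. -/
def NegSets {A : Type} (X : Set (ELit A)) : Set (Set (ELit A)) :=
  {T | (∀ e ∈ X, (negDep e X).Nonempty → ∃! t, t ∈ T ∧ t ∈ negDep e X) ∧
       (∀ t ∈ T, ∃ e ∈ X, t ∈ negDep e X)}

/-- All blanket conditions except `⊆`-minimality: nonempty, no complementary pair,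
no reconcilable pair, atoms disjoint from the atoms of `B(r)`, and meeting the body
of every adversarial rule of `r`. -/
def PreBlanket {A : Type} (P : Set (Rule A)) (r : Rule A) (β : Set (ELit A)) : Prop :=
  β.Nonempty ∧
  (∀ e ∈ β, ∀ e' ∈ β, ¬ EComp e e') ∧
  (∀ e ∈ β, ∀ e' ∈ β, ¬ EReconc e e') ∧
  (∀ e ∈ β, ∀ e' ∈ r.body, e.atom ≠ ELit.atom e') ∧
  (∀ rj ∈ Adv P r, ∃ e ∈ β, e ∈ rj.body)

/-- A blanket for `Adv(r)` (with ambient program `P`): a `⊆`-minimal set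
satisfying the blanket conditions. -/
def Blanket {A : Type} (P : Set (Rule A)) (r : Rule A) (β : Set (ELit A)) : Prop :=
  PreBlanket P r β ∧ ∀ β' ⊆ β, PreBlanket P r β' → β' = β

/-- A set satisfying the body of a rule contains its positive body literals and is
disjoint from its default-negated ones. -/
theorem satAll_body_iff {A : Type} (S : Set (CLit A)) (r : Rule A) :
    SatAll S ↑r.body ↔ r.bodyPos ⊆ S ∧ Disjoint S r.bodyNeg := by
  rw [Set.disjoint_right]
  constructor
  · exact fun h => ⟨fun L hL => h (ELit.lit L) hL, fun L hL => h (ELit.not L) hL⟩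
  · rintro ⟨hpos, hneg⟩ (L | L) hL
    · exact hpos hL
    · exact hneg hL

theorem Consistent.mono {A : Type} {S T : Set (CLit A)} (hT : Consistent T) (h : S ⊆ T) :
    Consistent S :=
  fun L hL hc => hT L (h hL) (h hc)

theorem Applicable.disjoint_bodyPos_bodyNeg {A : Type} {r : Rule A} (h : Applicable r) :
    Disjoint r.bodyPos r.bodyNeg := by
  obtain ⟨S, -, hS⟩ := h
  rw [satAll_body_iff] at hS
  exact hS.2.mono_left hS.1

/-- Two applicable rules `r ≠ r'` are conflicting iff
(CP1) their heads are strongly complementary, (CP2) `B⁺(r) ∩ B⁻(r') = ∅` and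
`B⁺(r') ∩ B⁻(r) = ∅`, and (CP3) `B⁺(r) ∪ B⁺(r')` is consistent. -/
theorem stmt_0 {A : Type} (r r' : Rule A) (hne : r ≠ r')
    (happ : Applicable r) (happ' : Applicable r') :
    Conflicting r r' ↔
      StronglyComp r.head r'.head ∧
      (r.bodyPos ∩ r'.bodyNeg = ∅ ∧ r'.bodyPos ∩ r.bodyNeg = ∅) ∧
      Consistent (r.bodyPos ∪ r'.bodyPos) := by
  simp only [← Set.disjoint_iff_inter_eq_empty]
  constructor
  · rintro ⟨-, hhead, S, hS, hr, hr'⟩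
    rw [satAll_body_iff] at hr hr'
    exact ⟨hhead, ⟨hr'.2.mono_left hr.1, hr.2.mono_left hr'.1⟩,
      hS.mono (Set.union_subset hr.1 hr'.1)⟩
  · rintro ⟨hhead, ⟨h₁, h₂⟩, hcons⟩
    refine ⟨hne, hhead, r.bodyPos ∪ r'.bodyPos, hcons, ?_, ?_⟩
    · exact (satAll_body_iff _ _).2 ⟨Set.subset_union_left,
        happ.disjoint_bodyPos_bodyNeg.union_left h₂⟩
    · exact (satAll_body_iff _ _).2 ⟨Set.subset_union_right,
        h₁.union_left happ'.disjoint_bodyPos_bodyNeg⟩
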